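/- Let K: 𝕋^{d-1}×𝕋^ℓ → U ⊂ ℝ^{2n} be a C¹ parameterization, let Ω: U → ℝ^{2n×2n} be a (possibly z-dependent) matrix field of the form Ω(z) = Da(z)ᵀ − Da(z) for some C¹ map a: U → ℝ^{2n}, and suppose F: U×𝕋^ℓ → U is C¹, fiberwise symplectic (D_zF(z,φ)ᵀ Ω(F(z,φ)) D_zF(z,φ) = Ω(z)), and satisfies the invariance F(K(θ,φ),φ) = K(θ+ω, φ+α) with (ω,α,1) rationally independent. Then for all (θ,φ), D_θK(θ,φ)ᵀ Ω(K(θ,φ)) D_θK(θ,φ) = 0; that is, each torus K(·,φ) is isotropic. -/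

import Mathlib

/-- Matrix of the exact 2-form `Ω(z) = Da(z)ᵀ − Da(z)` associated to an action
1-form with coordinate representation `a`:  `Ω(z)_{pq} = ∂a_q/∂z_p − ∂a_p/∂z_q`. -/
noncomputable def exactOmega {N : ℕ} (a : (Fin N → ℝ) → (Fin N → ℝ))
    (z : Fin N → ℝ) (p q : Fin N) : ℝ :=
  fderiv ℝ a z (Pi.single p 1) q - fderiv ℝ a z (Pi.single q 1) p

open MeasureTheory Filter Topology

abbrev TT (m ℓ : ℕ) := Fin m ⊕ Fin ℓ → UnitAddCircle

noncomputable def tmu (m ℓ : ℕ) : Measure (TT m ℓ) :=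
  Measure.pi (fun _ => (AddCircle.haarAddCircle : Measure (AddCircle (1 : ℝ))))

instance (m ℓ : ℕ) : IsProbabilityMeasure (tmu m ℓ) := by
  unfold tmu; infer_instance

instance (m ℓ : ℕ) : (tmu m ℓ).IsAddLeftInvariant := by
  unfold tmu; infer_instance
instance (m ℓ : ℕ) : (tmu m ℓ).IsAddRightInvariant := by
  unfold tmu; infer_instance

abbrev XX (m ℓ : ℕ) := (Fin m → ℝ) × (Fin ℓ → ℝ)

def prj {m ℓ : ℕ} (x : XX m ℓ) : TT m ℓ :=
  fun i => ((Sum.elim x.1 x.2 i : ℝ) : UnitAddCircle)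

lemma prj_add {m ℓ : ℕ} (x y : XX m ℓ) : prj (x + y) = prj x + prj y := by
  funext i
  rcases i with i | i <;> simp [prj]

lemma prj_quot (m ℓ : ℕ) : IsOpenQuotientMap (prj : XX m ℓ → TT m ℓ) := by
  have h1 : IsOpenQuotientMap (Pi.map (fun (_ : Fin m ⊕ Fin ℓ) (t : ℝ) => (t : UnitAddCircle))) :=
    IsOpenQuotientMap.piMap (fun _ => QuotientAddGroup.isOpenQuotientMap_mk)
  have h2 : IsOpenQuotientMap (Homeomorph.sumArrowHomeomorphProdArrow (X := ℝ) (ι := Fin m) (ι' := Fin ℓ)).symm :=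
    (Homeomorph.sumArrowHomeomorphProdArrow (X := ℝ) (ι := Fin m) (ι' := Fin ℓ)).symm.isOpenQuotientMap
  have := h1.comp h2
  convert! this using 1

def Per {m ℓ : ℕ} {E : Type*} (G : XX m ℓ → E) : Prop :=
  ∀ (x : XX m ℓ) (p : Fin m → ℤ) (q : Fin ℓ → ℤ),
      G (x.1 + fun i => ((p i : ℝ)), x.2 + fun i => ((q i : ℝ))) = G x

lemma Per.eq {m ℓ : ℕ} {E : Type*} {G : XX m ℓ → E} (hG : Per G) {x y : XX m ℓ}
    (h : prj x = prj y) : G x = G y := by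
  have h' : ∀ i, ∃ k : ℤ, (Sum.elim x.1 x.2 i : ℝ) = Sum.elim y.1 y.2 i + k := by
    intro i
    have := congrFun h i
    simp only [prj] at this
    rw [QuotientAddGroup.eq] at this
    obtain ⟨k, hk⟩ := AddSubgroup.mem_zmultiples_iff.1 this
    refine ⟨-k, ?_⟩
    push_cast
    simp at hk
    linarith
  choose k hk using h'
  rw [← hG y (fun i => k (Sum.inl i)) (fun i => k (Sum.inr i))]
  congr 1
  ext i
  · simpa using hk (Sum.inl i)
  · simpa using hk (Sum.inr i)

noncomputable def sec {m ℓ : ℕ} (y : TT m ℓ) : XX m ℓ := ((prj_quot m ℓ).surjective y).choose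
lemma prj_sec {m ℓ : ℕ} (y : TT m ℓ) : prj (sec y) = y := ((prj_quot m ℓ).surjective y).choose_spec

lemma Per.lift {m ℓ : ℕ} {E : Type*} {G : XX m ℓ → E} (hG : Per G) (x : XX m ℓ) :
    G (sec (prj x)) = G x := hG.eq (prj_sec _)

lemma Per.cont {m ℓ : ℕ} {E : Type*} [TopologicalSpace E] {G : XX m ℓ → E} (hG : Per G)
    (hc : Continuous G) : Continuous (fun y => G (sec y)) := by
  rw [← (prj_quot m ℓ).continuous_comp_iff]
  convert hc using 1
  funext x
  exact hG.lift x

noncomputable def mean {m ℓ : ℕ} (G : XX m ℓ → ℝ) : ℝ := ∫ y, G (sec y) ∂(tmu m ℓ)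

lemma Per.integrable {m ℓ : ℕ} {G : XX m ℓ → ℝ} (hG : Per G)
    (hc : Continuous G) : Integrable (fun y => G (sec y)) (tmu m ℓ) :=
  (hG.cont hc).integrable_of_hasCompactSupport (HasCompactSupport.of_compactSpace _)

lemma Per.lift_add {m ℓ : ℕ} {E : Type*} {G : XX m ℓ → E} (hG : Per G) (y : TT m ℓ) (c : XX m ℓ) :
    G (sec y + c) = G (sec (y + prj c)) := by
  apply hG.eq
  rw [prj_add, prj_sec, prj_sec]

lemma Per.mean_shift {m ℓ : ℕ} {G : XX m ℓ → ℝ} (hG : Per G) (c : XX m ℓ) :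
    mean (fun x => G (x + c)) = mean G := by
  unfold mean
  simp only [hG.lift_add]
  exact integral_add_right_eq_self (fun y => G (sec y)) (prj c)

lemma Per.shift {m ℓ : ℕ} {E : Type*} {G : XX m ℓ → E} (hG : Per G) (c : XX m ℓ) :
    Per (fun x => G (x + c)) := by
  intro x p q
  have := hG (x + c) p q
  simp only
  rw [← this]
  congr 1
  ext i <;> simp <;> ring

lemma Per.fderiv {m ℓ : ℕ} {E : Type*} [NormedAddCommGroup E] [NormedSpace ℝ E]
    {G : XX m ℓ → E} (hG : Per G) : Per (fderiv ℝ G) := by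
  intro x p q
  have h : (fun y : XX m ℓ => G (y + (fun i => ((p i : ℝ)), fun i => ((q i : ℝ))))) = G := by
    funext y; exact hG y p q
  conv_rhs => rw [← h]
  rw [fderiv_comp_add_right]
  rfl

/-- periodic continuous function invariant under irrational rotation is its mean -/
lemma Per.const {m ℓ : ℕ} {G : XX m ℓ → ℝ} (hG : Per G) (hc : Continuous G)
    (ω : Fin m → ℝ) (α : Fin ℓ → ℝ)
    (hirr : ∀ (k : Fin m → ℤ) (j : Fin ℓ → ℤ), ¬(k = 0 ∧ j = 0) →
      ∀ N : ℤ, (∑ i, (k i : ℝ) * ω i) + (∑ i, (j i : ℝ) * α i) ≠ (N : ℝ))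
    (hinv : ∀ x, G (x + (ω, α)) = G x) (x : XX m ℓ) : G x = mean G := by
  let g : C(UnitAddTorus (Fin m ⊕ Fin ℓ), ℂ) :=
    ⟨fun y => ((G (sec y) : ℝ) : ℂ), Complex.continuous_ofReal.comp (hG.cont hc)⟩
  have hginv : ∀ y, g (y + prj (ω, α)) = g y := by
    intro y
    simp only [g, ContinuousMap.coe_mk]
    rw [← hG.lift_add, hinv]
  have hcoef : ∀ k, UnitAddTorus.mFourierCoeff g k =
      ∫ y, UnitAddTorus.mFourier (-k) y * g y ∂(tmu m ℓ) := fun k => rfl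
  have hmul : ∀ (k : Fin m ⊕ Fin ℓ → ℤ) (y z : UnitAddTorus (Fin m ⊕ Fin ℓ)),
      UnitAddTorus.mFourier k (y + z) = UnitAddTorus.mFourier k y * UnitAddTorus.mFourier k z := by
    intro k y z
    simp [UnitAddTorus.mFourier, fourier_apply, Finset.prod_mul_distrib, AddCircle.toCircle_add]
    ring
  have hval : ∀ k : Fin m ⊕ Fin ℓ → ℤ, k ≠ 0 → UnitAddTorus.mFourier k (prj (ω, α)) ≠ 1 := by
    intro k hk h
    have h1 : UnitAddTorus.mFourier k (prj (ω, α)) =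
        Complex.exp (2 * Real.pi * Complex.I * ((∑ i, (k (Sum.inl i) : ℝ) * ω i) + (∑ i, (k (Sum.inr i) : ℝ) * α i) : ℝ)) := by
      simp only [UnitAddTorus.mFourier, ContinuousMap.coe_mk, prj, fourier_coe_apply,
        ← Complex.exp_sum, Fintype.sum_sum_type]
      congr 1
      push_cast
      rw [mul_add, Finset.mul_sum, Finset.mul_sum]
      congr 1 <;> refine Finset.sum_congr rfl fun i _ => ?_ <;> simp <;> ring
    rw [h1, Complex.exp_eq_one_iff] at h
    obtain ⟨N, hN⟩ := h
    refine hirr (fun i => k (Sum.inl i)) (fun i => k (Sum.inr i)) ?_ N ?_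
    · rintro ⟨h2, h3⟩
      apply hk
      funext i
      rcases i with i | i
      · exact congrFun h2 i
      · exact congrFun h3 i
    · have : (2 * Real.pi * Complex.I : ℂ) ≠ 0 := Complex.two_pi_I_ne_zero
      have h4 := mul_left_cancel₀ this (hN.trans (mul_comm _ _))
      exact_mod_cast h4
  have hzero : ∀ k, k ≠ 0 → UnitAddTorus.mFourierCoeff g k = 0 := by
    intro k hk
    have h1 : UnitAddTorus.mFourierCoeff g k =
        UnitAddTorus.mFourier (-k) (prj (ω, α)) * UnitAddTorus.mFourierCoeff g k := by
      rw [hcoef, ← integral_const_mul]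
      rw [← integral_add_right_eq_self (μ := tmu m ℓ)
        (fun y => UnitAddTorus.mFourier (-k) y * g y) (prj (ω, α))]
      refine integral_congr_ae (Eventually.of_forall fun y => ?_)
      simp only
      rw [hginv, hmul]
      ring
    have h2 := hval (-k) (neg_ne_zero.2 hk)
    by_contra h3
    exact h2 (mul_right_cancel₀ h3 (by rw [← h1, one_mul]))
  have hs := UnitAddTorus.hasSum_mFourier_series_apply_of_summable (f := g)
    (summable_of_ne_finset_zero (s := {0}) (fun k hk => hzero k (by simpa using hk))) (prj x)
  have hs2 := hasSum_single (f := fun i => UnitAddTorus.mFourierCoeff g i • UnitAddTorus.mFourier i (prj x)) 0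
    (fun k hk => by rw [hzero k hk, zero_smul])
  have := hs.unique hs2
  rw [hcoef] at this
  simp only [neg_zero, UnitAddTorus.mFourier_zero, ContinuousMap.one_apply, one_mul, smul_eq_mul, mul_one] at this
  simp only [g, ContinuousMap.coe_mk] at this
  rw [hG.lift, integral_complex_ofReal] at this
  exact_mod_cast this

lemma Per.jac_aux {m ℓ : ℕ} {b f : XX m ℓ → ℝ} (hb : Per b) (hf : Per f)
    (hbc : Continuous b) (hfc : Continuous f) (s t : XX m ℓ) :
    mean (fun x => (b (x + s) - b x) * (f (x + t) - f x)) =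
    mean (fun x => (b (x + -t) - b x) * (f (x + -s) - f x)) := by
  have hmul : ∀ {c d : XX m ℓ → ℝ}, Per c → Per d → Per (fun x => c x * d x) := by
    intro c d h1 h2 x p q
    simp only
    rw [h1, h2]
  have key : ∀ s t : XX m ℓ, mean (fun x => (b (x + s) - b x) * (f (x + t) - f x)) =
      mean (fun x => b (x + s) * f (x + t)) - mean (fun x => b (x + s) * f x)
       - mean (fun x => b x * f (x + t)) + mean (fun x => b x * f x) := by
    intro s t
    have i1 := (hmul (hb.shift s) (hf.shift t)).integrable (by fun_prop)
    have i2 := (hmul (hb.shift s) hf).integrable (by fun_prop)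
    have i3 := (hmul hb (hf.shift t)).integrable (by fun_prop)
    have i4 := (hmul hb hf).integrable (by fun_prop)
    unfold mean
    have i12 : Integrable (fun y => b (sec y + s) * f (sec y + t) - b (sec y + s) * f (sec y))
      (tmu m ℓ) := i1.sub i2
    have i123 : Integrable (fun y => b (sec y + s) * f (sec y + t) - b (sec y + s) * f (sec y)
      - b (sec y) * f (sec y + t)) (tmu m ℓ) := i12.sub i3
    rw [← integral_sub i1 i2, ← integral_sub i12 i3, ← integral_add i123 i4]
    congr 1
    funext y
    simp
    ring
  rw [key, key]
  have e1 : mean (fun x => b (x + s) * f (x + t)) = mean (fun x => b (x + -t) * f (x + -s)) := by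
    rw [← (hmul (hb.shift (-t)) (hf.shift (-s))).mean_shift (s + t)]
    congr 1; funext x
    congr 2 <;> abel
  have e2 : mean (fun x => b (x + s) * f x) = mean (fun x => b x * f (x + -s)) := by
    rw [← (hmul hb (hf.shift (-s))).mean_shift s]
    congr 1; funext x
    congr 2; abel
  have e3 : mean (fun x => b x * f (x + t)) = mean (fun x => b (x + -t) * f x) := by
    rw [← (hmul (hb.shift (-t)) hf).mean_shift t]
    congr 1; funext x
    congr 2; abel
  rw [e1, e2, e3]; ring

lemma Per.lip {m ℓ : ℕ} {b : XX m ℓ → ℝ} (hb : Per b) (hbc : ContDiff ℝ 1 b) :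
    ∃ C, 0 ≤ C ∧ ∀ x s, |b (x + s) - b x| ≤ C * ‖s‖ := by
  have hc : Continuous (fun y => _root_.fderiv ℝ b (sec y)) :=
    hb.fderiv.cont (hbc.continuous_fderiv one_ne_zero)
  obtain ⟨C, hC⟩ := isCompact_univ.exists_bound_of_continuousOn hc.continuousOn
  have hC' : ∀ x, ‖_root_.fderiv ℝ b x‖ ≤ C := fun x => by
    rw [← hb.fderiv.lift]; exact hC _ trivial
  refine ⟨C, (norm_nonneg _).trans (hC' 0), fun x s => ?_⟩
  have := convex_univ.norm_image_sub_le_of_norm_fderiv_le (𝕜 := ℝ) (f := b)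
    (fun x _ => (hbc.differentiable one_ne_zero) x) (fun x _ => hC' x) (Set.mem_univ x) (Set.mem_univ (x + s))
  simpa using this

lemma Per.jac_lim {m ℓ : ℕ} {b f : XX m ℓ → ℝ} (hb : Per b) (hf : Per f)
    (hbc : ContDiff ℝ 1 b) (hfc : ContDiff ℝ 1 f) (s t : XX m ℓ) :
    Tendsto (fun h : ℝ => h⁻¹ * h⁻¹ * mean (fun x => (b (x + h • s) - b x) * (f (x + h • t) - f x)))
      (𝓝[≠] 0) (𝓝 (mean (fun x => _root_.fderiv ℝ b x s * _root_.fderiv ℝ f x t))) := by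
  obtain ⟨C, hC0, hC⟩ := hb.lip hbc
  obtain ⟨D, hD0, hD⟩ := hf.lip hfc
  unfold mean
  simp only [← integral_const_mul]
  refine tendsto_integral_filter_of_dominated_convergence (fun _ => (C * ‖s‖) * (D * ‖t‖)) ?_ ?_ ?_ ?_
  · refine Eventually.of_forall fun h => ?_
    have h1 : Per (fun x => (b (x + h • s) - b x) * (f (x + h • t) - f x)) := by
      intro x p q
      have h2 := hb.shift (h • s) x p q
      have h3 := hf.shift (h • t) x p q
      simp only at h2 h3 ⊢
      rw [h2, h3, hb, hf]
    have hb' := hbc.continuous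
    have hf' := hfc.continuous
    exact ((h1.integrable (by fun_prop)).const_mul _).aestronglyMeasurable
  · filter_upwards [self_mem_nhdsWithin] with h hh
    refine Eventually.of_forall fun y => ?_
    have hh' : 0 < |h| := abs_pos.2 hh
    have h1 := hC (sec y) (h • s)
    have h2 := hD (sec y) (h • t)
    rw [norm_smul, Real.norm_eq_abs] at h1 h2
    rw [Real.norm_eq_abs, abs_mul, abs_mul, abs_mul, abs_inv]
    calc _ ≤ |h|⁻¹ * |h|⁻¹ * ((C * (|h| * ‖s‖)) * (D * (|h| * ‖t‖))) := by gcongr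
      _ = _ := by field_simp
  · exact integrable_const _
  · refine Eventually.of_forall fun y => ?_
    have l : ∀ {c : XX m ℓ → ℝ} (_ : ContDiff ℝ 1 c) (s : XX m ℓ),
        Tendsto (fun h : ℝ => h⁻¹ * (c (sec y + h • s) - c (sec y))) (𝓝[≠] 0) (𝓝 (_root_.fderiv ℝ c (sec y) s)) := by
      intro c hc s
      have := (hc.differentiable one_ne_zero (sec y)).hasFDerivAt.hasLineDerivAt s
      have := this.tendsto_slope_zero
      simpa using this
    refine ((l hbc s).mul (l hfc t)).congr fun h => ?_
    ring

lemma Per.jac {m ℓ : ℕ} {b f : XX m ℓ → ℝ} (hb : Per b) (hf : Per f)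
    (hbc : ContDiff ℝ 1 b) (hfc : ContDiff ℝ 1 f) (s t : XX m ℓ) :
    mean (fun x => _root_.fderiv ℝ b x s * _root_.fderiv ℝ f x t) =
    mean (fun x => _root_.fderiv ℝ b x t * _root_.fderiv ℝ f x s) := by
  have h1 := hb.jac_lim hf hbc hfc s t
  have h2 := hb.jac_lim hf hbc hfc (-t) (-s)
  simp only [map_neg, neg_mul_neg] at h2
  refine tendsto_nhds_unique h1 (h2.congr fun h => ?_)
  rw [hb.jac_aux hf hbc.continuous hfc.continuous (h • s) (h • t)]
  simp only [smul_neg]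


lemma omega_sum {N : ℕ} (a : (Fin N → ℝ) → (Fin N → ℝ)) (z X Y : Fin N → ℝ) :
    (∑ p, ∑ q, X p * exactOmega a z p q * Y q) =
      ∑ q, (fderiv ℝ a z X q * Y q - fderiv ℝ a z Y q * X q) := by
  have h : ∀ (X : Fin N → ℝ) q, fderiv ℝ a z X q = ∑ p, X p * fderiv ℝ a z (Pi.single p 1) q := by
    intro X q
    conv_lhs => rw [pi_eq_sum_univ' X]
    simp [map_sum, Finset.sum_apply]
  simp only [exactOmega, mul_sub, sub_mul, Finset.sum_sub_distrib]
  congr 1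
  · rw [Finset.sum_comm]
    refine Finset.sum_congr rfl fun q _ => ?_
    rw [h X q, Finset.sum_mul]
  · refine Finset.sum_congr rfl fun p _ => ?_
    rw [h Y p, Finset.sum_mul]
    refine Finset.sum_congr rfl fun q _ => ?_
    ring

lemma mean_sum_zero {m ℓ : ℕ} {ι : Type*} [Fintype ι] {b f : ι → XX m ℓ → ℝ}
    (hb : ∀ i, Per (b i)) (hf : ∀ i, Per (f i))
    (hbc : ∀ i, ContDiff ℝ 1 (b i)) (hfc : ∀ i, ContDiff ℝ 1 (f i)) (s t : XX m ℓ) :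
    mean (fun x => ∑ i, (fderiv ℝ (b i) x s * fderiv ℝ (f i) x t
      - fderiv ℝ (b i) x t * fderiv ℝ (f i) x s)) = 0 := by
  have hi : ∀ i (s t : XX m ℓ), Integrable
      (fun y => fderiv ℝ (b i) (sec y) s * fderiv ℝ (f i) (sec y) t) (tmu m ℓ) := by
    intro i s t
    have hp : Per (fun x => fderiv ℝ (b i) x s * fderiv ℝ (f i) x t) := by
      intro x p q
      simp only
      rw [(hb i).fderiv x p q, (hf i).fderiv x p q]
    have c1 := (hbc i).continuous_fderiv one_ne_zero
    have c2 := (hfc i).continuous_fderiv one_ne_zero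
    exact hp.integrable (by fun_prop)
  unfold mean
  have hi2 : ∀ i, Integrable (fun y => fderiv ℝ (b i) (sec y) s * fderiv ℝ (f i) (sec y) t
      - fderiv ℝ (b i) (sec y) t * fderiv ℝ (f i) (sec y) s) (tmu m ℓ) :=
    fun i => (hi i s t).sub (hi i t s)
  rw [integral_finsetSum _ (fun i _ => hi2 i)]
  refine Finset.sum_eq_zero fun i _ => ?_
  rw [integral_sub (hi i s t) (hi i t s)]
  exact sub_eq_zero.2 ((hb i).jac (hf i) (hbc i) (hfc i) s t)



/-- fiberwise isotropy of invariant tori.  If `F` is fiberwise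
symplectic for the exact symplectic form `Ω = Daᵀ − Da` on the open set `U`,
and `K` parameterizes an `F`-invariant torus over a rotation `(ω,α)` with
`(ω,α,1)` rationally independent, then `D_θKᵀ Ω(K) D_θK = 0`: each torus
`K(·,φ)` is isotropic. -/
theorem fiberwise_isotropy
    (m ℓ n : ℕ) (U : Set (Fin (2 * n) → ℝ)) (hU : IsOpen U)
    (a : (Fin (2 * n) → ℝ) → (Fin (2 * n) → ℝ)) (ha : ContDiffOn ℝ 1 a U)
    (ω : Fin m → ℝ) (α : Fin ℓ → ℝ)
    (hirr : ∀ (k : Fin m → ℤ) (j : Fin ℓ → ℤ), ¬(k = 0 ∧ j = 0) →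
      ∀ N : ℤ, (∑ i, (k i : ℝ) * ω i) + (∑ i, (j i : ℝ) * α i) ≠ (N : ℝ))
    (K : (Fin m → ℝ) × (Fin ℓ → ℝ) → (Fin (2 * n) → ℝ))
    (hK : ContDiff ℝ 1 K)
    (hKU : ∀ x, K x ∈ U)
    (hKper : ∀ (x : (Fin m → ℝ) × (Fin ℓ → ℝ)) (p : Fin m → ℤ) (q : Fin ℓ → ℤ),
      K (x.1 + fun i => ((p i : ℝ)), x.2 + fun i => ((q i : ℝ))) = K x)
    (F : (Fin (2 * n) → ℝ) × (Fin ℓ → ℝ) → (Fin (2 * n) → ℝ))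
    (hF : ContDiffOn ℝ 1 F (U ×ˢ (Set.univ : Set (Fin ℓ → ℝ))))
    (hFU : ∀ z ∈ U, ∀ φv : Fin ℓ → ℝ, F (z, φv) ∈ U)
    (hsymp : ∀ z ∈ U, ∀ (φv : Fin ℓ → ℝ) (u v : Fin (2 * n) → ℝ),
      (∑ p, ∑ q, (fderiv ℝ (fun z' => F (z', φv)) z u) p *
        exactOmega a (F (z, φv)) p q * (fderiv ℝ (fun z' => F (z', φv)) z v) q)
        = ∑ p, ∑ q, u p * exactOmega a z p q * v q)
    (hinv : ∀ (θ : Fin m → ℝ) (φv : Fin ℓ → ℝ),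
      F (K (θ, φv), φv) = K (θ + ω, φv + α)) :
    ∀ (θ : Fin m → ℝ) (φv : Fin ℓ → ℝ) (u v : Fin m → ℝ),
      (∑ p, ∑ q, (fderiv ℝ (fun θ' => K (θ', φv)) θ u) p *
        exactOmega a (K (θ, φv)) p q *
        (fderiv ℝ (fun θ' => K (θ', φv)) θ v) q) = 0 := by
  intro θ φv u v
  have hKd : Differentiable ℝ K := hK.differentiable one_ne_zero
  have hpart : ∀ (θ : Fin m → ℝ) (φv : Fin ℓ → ℝ) (u : Fin m → ℝ),
      fderiv ℝ (fun θ' => K (θ', φv)) θ u = fderiv ℝ K (θ, φv) (u, 0) := by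
    intro θ φv u
    have h1 : HasFDerivAt (fun θ' : Fin m → ℝ => (θ', φv))
        (ContinuousLinearMap.inl ℝ (Fin m → ℝ) (Fin ℓ → ℝ)) θ := hasFDerivAt_prodMk_left θ φv
    have h2 := (hKd (θ, φv)).hasFDerivAt.comp θ h1
    have h3 := h2.fderiv
    rw [show (fun θ' => K (θ', φv)) = K ∘ (fun θ' : Fin m → ℝ => (θ', φv)) from rfl, h3]
    simp
  have hbC : ContDiff ℝ 1 (fun x => a (K x)) := by
    rw [← contDiffOn_univ]
    exact ha.comp hK.contDiffOn (fun x _ => hKU x)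
  have had : ∀ z ∈ U, DifferentiableAt ℝ a z := fun z hz =>
    (ha.differentiableOn one_ne_zero).differentiableAt (hU.mem_nhds hz)
  have hbd : ∀ x w, fderiv ℝ (fun x => a (K x)) x w = fderiv ℝ a (K x) (fderiv ℝ K x w) := by
    intro x w
    have := ((had _ (hKU x)).hasFDerivAt.comp x (hKd x).hasFDerivAt).fderiv
    rw [show (fun x => a (K x)) = a ∘ K from rfl, this]
    rfl
  have hKp : Per K := hKper
  have hbp : Per (fun x => a (K x)) := fun x p q => congrArg a (hKper x p q)
  let b : Fin (2 * n) → XX m ℓ → ℝ := fun i x => a (K x) i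
  let f : Fin (2 * n) → XX m ℓ → ℝ := fun i x => K x i
  have hfi : ∀ i x w, fderiv ℝ (f i) x w = fderiv ℝ K x w i := by
    intro i x w
    rw [fderiv_pi (fun i => differentiableAt_pi.1 (hKd x) i)]
    rfl
  have hbi : ∀ i x w, fderiv ℝ (b i) x w = fderiv ℝ a (K x) (fderiv ℝ K x w) i := by
    intro i x w
    rw [← hbd, fderiv_pi (fun i => differentiableAt_pi.1 (hbC.differentiable one_ne_zero x) i)]
    rfl
  have hbp' : ∀ i, Per (b i) := fun i x p q => congrFun (hbp x p q) i
  have hfp' : ∀ i, Per (f i) := fun i x p q => congrFun (hKp x p q) i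
  have hbC' : ∀ i, ContDiff ℝ 1 (b i) := fun i => contDiff_pi.1 hbC i
  have hfC' : ∀ i, ContDiff ℝ 1 (f i) := fun i => contDiff_pi.1 hK i
  have hM : ∀ (θ : Fin m → ℝ) (φv : Fin ℓ → ℝ), (∑ p, ∑ q, (fderiv ℝ (fun θ' => K (θ', φv)) θ u) p *
        exactOmega a (K (θ, φv)) p q *
        (fderiv ℝ (fun θ' => K (θ', φv)) θ v) q) =
      ∑ i, (fderiv ℝ (b i) (θ, φv) (u, 0) * fderiv ℝ (f i) (θ, φv) (v, 0)
        - fderiv ℝ (b i) (θ, φv) (v, 0) * fderiv ℝ (f i) (θ, φv) (u, 0)) := by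
    intro θ φv
    rw [omega_sum]
    simp only [hpart, hfi, hbi]
  let G : XX m ℓ → ℝ := fun x => ∑ i, (fderiv ℝ (b i) x (u, 0) * fderiv ℝ (f i) x (v, 0)
        - fderiv ℝ (b i) x (v, 0) * fderiv ℝ (f i) x (u, 0))
  have hGp : Per G := by
    intro x p q
    simp only [G]
    refine Finset.sum_congr rfl fun i _ => ?_
    rw [(hbp' i).fderiv x p q, (hfp' i).fderiv x p q]
  have hGc : Continuous G := by
    refine continuous_finsetSum _ fun i _ => ?_
    have c1 := (hbC' i).continuous_fderiv one_ne_zero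
    have c2 := (hfC' i).continuous_fderiv one_ne_zero
    fun_prop
  have hFd : ∀ (θ : Fin m → ℝ) (φv : Fin ℓ → ℝ),
      DifferentiableAt ℝ (fun z' => F (z', φv)) (K (θ, φv)) := by
    intro θ φv
    have h1 : DifferentiableAt ℝ F (K (θ, φv), φv) :=
      (hF.differentiableOn one_ne_zero).differentiableAt
        ((hU.prod isOpen_univ).mem_nhds ⟨hKU _, trivial⟩)
    exact h1.comp (K (θ, φv)) (hasFDerivAt_prodMk_left (𝕜 := ℝ) (K (θ, φv)) φv).differentiableAt
  have hder : ∀ (θ : Fin m → ℝ) (φv : Fin ℓ → ℝ) (w : Fin m → ℝ),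
      fderiv ℝ (fun θ' => K (θ', φv + α)) (θ + ω) w =
      fderiv ℝ (fun z' => F (z', φv)) (K (θ, φv)) (fderiv ℝ (fun θ' => K (θ', φv)) θ w) := by
    intro θ φv w
    have h1 : DifferentiableAt ℝ (fun θ' => K (θ', φv)) θ := by fun_prop
    have h2 := ((hFd θ φv).hasFDerivAt.comp θ h1.hasFDerivAt).fderiv
    rw [← fderiv_comp_add_right]
    rw [show (fun x => K (x + ω, φv + α)) = (fun z' => F (z', φv)) ∘ (fun θ' => K (θ', φv)) from
      funext fun x => (hinv x φv).symm, h2]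
    rfl
  have hGinv : ∀ x, G (x + (ω, α)) = G x := by
    rintro ⟨θ, φv⟩
    have h1 := hM (θ + ω) (φv + α)
    have h2 := hM θ φv
    have h3 := hsymp (K (θ, φv)) (hKU _) φv (fderiv ℝ (fun θ' => K (θ', φv)) θ u)
      (fderiv ℝ (fun θ' => K (θ', φv)) θ v)
    rw [hinv, ← hder, ← hder] at h3
    exact h1.symm.trans (h3.trans h2)
  rw [hM]
  exact (hGp.const hGc ω α hirr hGinv (θ, φv)).trans
    (mean_sum_zero hbp' hfp' hbC' hfC' (u, 0) (v, 0))
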